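/- Let R and B be disjoint finite sets of points in the plane with |R| = n and |B| = n or |B| = n - 1, where n ≥ 1, and suppose some line contains at least n points of P = R ∪ B. If P is neither collinear nor a near-pencil, then P determines at least |P| - 1 bichromatic lines. -/

import Mathlib

open scoped Classical

noncomputable section

/-- A line in the plane: the affine span of two distinct points. -/
def IsLine (L : Set (ℝ × ℝ)) : Prop :=
  ∃ p q : ℝ × ℝ, p ≠ q ∧ L = (affineSpan ℝ ({p, q} : Set (ℝ × ℝ)) : Set (ℝ × ℝ))

/-- The points of the finite set `P` lying on `L`. -/
def ptsOn (P : Finset (ℝ × ℝ)) (L : Set (ℝ × ℝ)) : Finset (ℝ × ℝ) :=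
  P.filter (fun x => x ∈ L)

/-- A line determined by `P`: contains at least two points of `P`. -/
def DeterminedLine (P : Finset (ℝ × ℝ)) (L : Set (ℝ × ℝ)) : Prop :=
  IsLine L ∧ 2 ≤ (ptsOn P L).card

/-- A bichromatic line: determined by `R ∪ B`, with at least one red and one blue point. -/
def BichromaticLine (R B : Finset (ℝ × ℝ)) (L : Set (ℝ × ℝ)) : Prop :=
  DeterminedLine (R ∪ B) L ∧ (∃ p ∈ R, p ∈ L) ∧ (∃ p ∈ B, p ∈ L)

/-- The number of bichromatic lines determined by `R ∪ B`. -/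
def nBichromatic (R B : Finset (ℝ × ℝ)) : ℕ :=
  {L : Set (ℝ × ℝ) | BichromaticLine R B L}.ncard

/-- A near-pencil: some line contains all but exactly one of the points of `P`. -/
def NearPencil (P : Finset (ℝ × ℝ)) : Prop :=
  ∃ L : Set (ℝ × ℝ), IsLine L ∧ (ptsOn P L).card = P.card - 1

/-- The line through two points, as a set. -/
def lineThrough (p q : ℝ × ℝ) : Set (ℝ × ℝ) :=
  (affineSpan ℝ ({p, q} : Set (ℝ × ℝ)) : Set (ℝ × ℝ))

lemma left_mem_lineThrough (p q : ℝ × ℝ) : p ∈ lineThrough p q :=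
  left_mem_affineSpan_pair ℝ p q

lemma right_mem_lineThrough (p q : ℝ × ℝ) : q ∈ lineThrough p q :=
  right_mem_affineSpan_pair ℝ p q

lemma isLine_lineThrough {p q : ℝ × ℝ} (h : p ≠ q) : IsLine (lineThrough p q) :=
  ⟨p, q, h, rfl⟩

lemma IsLine.eq_lineThrough {L : Set (ℝ × ℝ)} (hL : IsLine L) {x y : ℝ × ℝ}
    (hx : x ∈ L) (hy : y ∈ L) (hxy : x ≠ y) : L = lineThrough x y := by
  obtain ⟨p, q, -, rfl⟩ := hL
  exact congrArg (fun S : AffineSubspace ℝ (ℝ × ℝ) => (S : Set (ℝ × ℝ)))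
    (affineSpan_pair_eq_of_mem_of_mem_of_ne hx hy hxy).symm

lemma IsLine.eq_of_mem {L M : Set (ℝ × ℝ)} (hL : IsLine L) (hM : IsLine M) {x y : ℝ × ℝ}
    (hxL : x ∈ L) (hyL : y ∈ L) (hxM : x ∈ M) (hyM : y ∈ M) (hxy : x ≠ y) : L = M :=
  (hL.eq_lineThrough hxL hyL hxy).trans (hM.eq_lineThrough hxM hyM hxy).symm

lemma IsLine.collinear {L : Set (ℝ × ℝ)} (hL : IsLine L) : Collinear ℝ L := by
  obtain ⟨p, q, -, rfl⟩ := hL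
  have h := collinear_pair ℝ p q
  rwa [Collinear, ← direction_affineSpan] at h

/-- The lines through `x` and a point of `C`. -/
def linesThrough (x : ℝ × ℝ) (C : Finset (ℝ × ℝ)) : Finset (Set (ℝ × ℝ)) :=
  C.image (lineThrough x)

/-- The lines joining a point of `A` to a point of `C`. -/
def joiningLines (A C : Finset (ℝ × ℝ)) : Finset (Set (ℝ × ℝ)) :=
  A.biUnion fun x => linesThrough x C

lemma mem_joiningLines {A C : Finset (ℝ × ℝ)} {M : Set (ℝ × ℝ)} :
    M ∈ joiningLines A C ↔ ∃ x ∈ A, ∃ q ∈ C, lineThrough x q = M := by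
  simp [joiningLines, linesThrough]

lemma lineThrough_ne_of_notMem {L : Set (ℝ × ℝ)} (hL : IsLine L) {x y p q : ℝ × ℝ}
    (hx : x ∈ L) (hy : y ∈ L) (hp : p ∉ L) (hxy : x ≠ y) :
    lineThrough x p ≠ lineThrough y q := by
  intro h
  have hxp : x ≠ p := fun e => hp (e ▸ hx)
  have hLM : L = lineThrough x p := hL.eq_of_mem (isLine_lineThrough hxp) hx hy
    (left_mem_lineThrough x p) (h ▸ left_mem_lineThrough y q) hxy
  exact hp (hLM ▸ right_mem_lineThrough x p)

lemma disjoint_joiningLines {L : Set (ℝ × ℝ)} (hL : IsLine L) {A A' C C' : Finset (ℝ × ℝ)}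
    (hA : ∀ x ∈ A, x ∈ L) (hA' : ∀ x ∈ A', x ∈ L) (hC : ∀ q ∈ C, q ∉ L)
    (hAA' : Disjoint A A') : Disjoint (joiningLines A C) (joiningLines A' C') := by
  rw [Finset.disjoint_left]
  intro M hM hM'
  obtain ⟨x, hx, p, hp, rfl⟩ := mem_joiningLines.1 hM
  obtain ⟨y, hy, q, hq, h⟩ := mem_joiningLines.1 hM'
  exact lineThrough_ne_of_notMem hL (hA x hx) (hA' y hy) (hC p hp)
    (Finset.disjoint_iff_ne.1 hAA' x hx y hy) h.symm

lemma card_joiningLines {L : Set (ℝ × ℝ)} (hL : IsLine L) {A C : Finset (ℝ × ℝ)}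
    (hA : ∀ x ∈ A, x ∈ L) (hC : ∀ q ∈ C, q ∉ L) :
    (joiningLines A C).card = ∑ x ∈ A, (linesThrough x C).card := by
  refine Finset.card_biUnion fun x hx y hy hxy => ?_
  simp only [Function.onFun, Finset.disjoint_left, linesThrough, Finset.mem_image, not_exists,
    not_and]
  rintro M ⟨p, hp, rfl⟩ q hq h
  exact lineThrough_ne_of_notMem hL (hA x hx) (hA y hy) (hC p hp) hxy h.symm

lemma card_le_card_joiningLines {L : Set (ℝ × ℝ)} (hL : IsLine L) {A C : Finset (ℝ × ℝ)}
    (hA : ∀ x ∈ A, x ∈ L) (hC : ∀ q ∈ C, q ∉ L) (hne : C.Nonempty) :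
    A.card ≤ (joiningLines A C).card := by
  rw [card_joiningLines hL hA hC]
  simpa using Finset.card_nsmul_le_sum A (fun x => (linesThrough x C).card) 1
    fun x _ => Finset.card_pos.2 (hne.image _)

/-- If all points of `C` are on one line through `x ∈ L`, every other point of `L` sees them in
pairwise different directions. -/
lemma card_linesThrough_eq_card {L : Set (ℝ × ℝ)} (hL : IsLine L) {C : Finset (ℝ × ℝ)}
    (hC : ∀ q ∈ C, q ∉ L) {x y : ℝ × ℝ} (hx : x ∈ L) (hy : y ∈ L) (hxy : y ≠ x)
    (h1 : (linesThrough x C).card ≤ 1) : (linesThrough y C).card = C.card := by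
  refine Finset.card_image_of_injOn fun p hp q hq hpq => ?_
  by_contra hne
  have hxpq : lineThrough x p = lineThrough x q :=
    Finset.card_le_one.1 h1 _ (Finset.mem_image_of_mem _ hp) _ (Finset.mem_image_of_mem _ hq)
  have hxp : x ≠ p := fun e => hC p hp (e ▸ hx)
  have hyp : y ≠ p := fun e => hC p hp (e ▸ hy)
  refine lineThrough_ne_of_notMem (q := p) hL hy hx (hC p hp) hxy ?_
  exact (isLine_lineThrough hyp).eq_of_mem (isLine_lineThrough hxp) (right_mem_lineThrough y p)
    (hpq ▸ right_mem_lineThrough y q) (right_mem_lineThrough x p)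
    (hxpq ▸ right_mem_lineThrough x q) hne

lemma two_mul_card_le_or_le_card_joiningLines {L : Set (ℝ × ℝ)} (hL : IsLine L)
    {A C : Finset (ℝ × ℝ)} (hA : ∀ x ∈ A, x ∈ L) (hC : ∀ q ∈ C, q ∉ L) (hne : C.Nonempty) :
    2 * A.card ≤ (joiningLines A C).card ∨
      1 ≤ A.card ∧ 1 + (A.card - 1) * C.card ≤ (joiningLines A C).card := by
  rw [card_joiningLines hL hA hC]
  by_cases h : ∀ x ∈ A, 2 ≤ (linesThrough x C).card
  · left
    simpa [mul_comm] using Finset.card_nsmul_le_sum A _ 2 h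
  · right
    push Not at h
    obtain ⟨x, hx, hlt⟩ := h
    refine ⟨Finset.card_pos.2 ⟨x, hx⟩, ?_⟩
    rw [← Finset.add_sum_erase A _ hx, ← Finset.card_erase_of_mem hx]
    refine Nat.add_le_add (Finset.card_pos.2 (hne.image _)) ?_
    rw [Finset.sum_congr rfl fun y hy => card_linesThrough_eq_card hL hC (hA x hx)
      (hA y (Finset.mem_of_mem_erase hy)) (Finset.ne_of_mem_erase hy) (by omega)]
    simp

lemma bichromaticLine_of_mem {R B : Finset (ℝ × ℝ)} (hRB : Disjoint R B) {L : Set (ℝ × ℝ)}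
    (hL : IsLine L) {p q : ℝ × ℝ} (hp : p ∈ R) (hq : q ∈ B) (hpL : p ∈ L) (hqL : q ∈ L) :
    BichromaticLine R B L :=
  ⟨⟨hL, Finset.one_lt_card.2 ⟨p, by simp [ptsOn, hp, hpL], q, by simp [ptsOn, hq, hqL],
    Finset.disjoint_iff_ne.1 hRB p hp q hq⟩⟩, ⟨p, hp, hpL⟩, ⟨q, hq, hqL⟩⟩

lemma finite_setOf_bichromaticLine {R B : Finset (ℝ × ℝ)} (hRB : Disjoint R B) :
    {L : Set (ℝ × ℝ) | BichromaticLine R B L}.Finite := by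
  refine (joiningLines R B).finite_toSet.subset ?_
  rintro L ⟨⟨hL, -⟩, ⟨p, hp, hpL⟩, ⟨q, hq, hqL⟩⟩
  exact mem_joiningLines.2 ⟨p, hp, q, hq,
    (hL.eq_lineThrough hpL hqL (Finset.disjoint_iff_ne.1 hRB p hp q hq)).symm⟩

/-- If `a` of the `n` red points and `b` of the `β` blue points lie on a line, with `r` and `s`
points off it, then bounds on the numbers `f` and `g` of joining lines give `n + β - 1` lines. -/
lemma add_sub_one_le_of_joining_bounds {a b r s n β f g N : ℕ} (ha : a + r = n) (hb : b + s = β)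
    (hβ : β = n ∨ β = n - 1) (hab : n ≤ a + b) (hrs : 2 ≤ r + s)
    (hf : 1 ≤ s → a ≤ f) (hf' : 1 ≤ s → 2 * a ≤ f ∨ 1 ≤ a ∧ 1 + (a - 1) * s ≤ f)
    (hg : 1 ≤ r → b ≤ g) (hg' : 1 ≤ r → 2 * b ≤ g ∨ 1 ≤ b ∧ 1 + (b - 1) * r ≤ g)
    (hN : f + g ≤ N) (hN' : 1 ≤ a → 1 ≤ b → f + g + 1 ≤ N) : n + β - 1 ≤ N := by
  have key : ∀ u v w : ℕ, 2 ≤ v → 2 * u ≤ w ∨ 1 ≤ u ∧ 1 + (u - 1) * v ≤ w →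
      2 * u ≤ w ∨ 2 * u - 1 ≤ w ∧ (2 ≤ u → u + v - 1 ≤ w) := by
    rintro u v w hv (h | ⟨hu, hw⟩)
    · exact Or.inl h
    · right
      obtain ⟨u, rfl⟩ := Nat.exists_eq_add_of_le' hu
      obtain ⟨v, rfl⟩ := Nat.exists_eq_add_of_le' hv
      simp only [Nat.add_sub_cancel] at hw
      refine ⟨?_, fun h2 => ?_⟩
      · have : 2 * u + 1 ≤ w := by nlinarith [Nat.zero_le (u * v)]
        omega
      · have : u + v + 2 ≤ w := by
          have hu1 : 1 ≤ u := by omega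
          nlinarith [Nat.mul_le_mul_right v hu1]
        omega
  have hf2 : 2 ≤ s → _ := fun h => key a s f h (hf' (by omega))
  have hg2 : 2 ≤ r → _ := fun h => key b r g h (hg' (by omega))
  clear key hf' hg'
  omega

/-- **Lemma 2.4.** There is no counterexample to the main theorem with `n`
collinear points: if some line contains at least `n` points of `P = R ∪ B` and `P`
is neither collinear nor a near-pencil, then there are at least `|P| - 1`
bichromatic lines. -/
theorem bichromatic_lines_of_n_collinear
    (n : ℕ) (hn : 1 ≤ n) (R B : Finset (ℝ × ℝ)) (hRB : Disjoint R B)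
    (hR : R.card = n) (hB : B.card = n ∨ B.card = n - 1)
    (hbig : ∃ L : Set (ℝ × ℝ), IsLine L ∧ n ≤ (ptsOn (R ∪ B) L).card)
    (hcol : ¬ Collinear ℝ ((R ∪ B : Finset (ℝ × ℝ)) : Set (ℝ × ℝ)))
    (hnp : ¬ NearPencil (R ∪ B)) :
    (R ∪ B).card - 1 ≤ nBichromatic R B := by
  obtain ⟨L, hL, hbig⟩ := hbig
  have hRc : (R.filter (· ∈ L)).card + (R.filter (· ∉ L)).card = R.card :=
    Finset.card_filter_add_card_filter_not _
  have hBc : (B.filter (· ∈ L)).card + (B.filter (· ∉ L)).card = B.card :=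
    Finset.card_filter_add_card_filter_not _
  have hP : (ptsOn (R ∪ B) L).card = (R.filter (· ∈ L)).card + (B.filter (· ∈ L)).card := by
    rw [ptsOn, Finset.filter_union,
      Finset.card_union_of_disjoint (Finset.disjoint_filter_filter hRB)]
  have hPc : (R ∪ B).card = R.card + B.card := Finset.card_union_of_disjoint hRB
  have hne : (ptsOn (R ∪ B) L).card ≠ (R ∪ B).card := fun h => hcol <|
    hL.collinear.subset fun x hx => Finset.filter_card_eq h x hx
  have hne' : (ptsOn (R ∪ B) L).card ≠ (R ∪ B).card - 1 := fun h => hnp ⟨L, hL, h⟩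
  have hRL : ∀ x ∈ R.filter (· ∈ L), x ∈ L := fun x hx => (Finset.mem_filter.1 hx).2
  have hBL : ∀ x ∈ B.filter (· ∈ L), x ∈ L := fun x hx => (Finset.mem_filter.1 hx).2
  have hRL' : ∀ x ∈ R.filter (· ∉ L), x ∉ L := fun x hx => (Finset.mem_filter.1 hx).2
  have hBL' : ∀ x ∈ B.filter (· ∉ L), x ∉ L := fun x hx => (Finset.mem_filter.1 hx).2
  set F := joiningLines (R.filter (· ∈ L)) (B.filter (· ∉ L)) with hF
  set G := joiningLines (B.filter (· ∈ L)) (R.filter (· ∉ L)) with hG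
  have hFG : (F ∪ G).card = F.card + G.card := Finset.card_union_of_disjoint <|
    disjoint_joiningLines hL hRL hBL hBL' (Finset.disjoint_filter_filter hRB)
  have hsub : ∀ M ∈ F ∪ G, BichromaticLine R B M ∧ M ≠ L := by
    intro M hM
    rcases Finset.mem_union.1 hM with hM | hM <;>
    · obtain ⟨x, hx, q, hq, rfl⟩ := mem_joiningLines.1 hM
      rw [Finset.mem_filter] at hx hq
      have hline := isLine_lineThrough (fun e => hq.2 (e ▸ hx.2) : x ≠ q)
      refine ⟨?_, fun h => hq.2 (h ▸ right_mem_lineThrough x q)⟩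
      first
      | exact bichromaticLine_of_mem hRB hline hx.1 hq.1 (left_mem_lineThrough x q)
          (right_mem_lineThrough x q)
      | exact bichromaticLine_of_mem hRB hline hq.1 hx.1 (right_mem_lineThrough x q)
          (left_mem_lineThrough x q)
  have hcount : ∀ S : Finset (Set (ℝ × ℝ)), (∀ M ∈ S, BichromaticLine R B M) →
      S.card ≤ nBichromatic R B := by
    intro S hS
    rw [← Set.ncard_coe_finset]
    exact Set.ncard_le_ncard hS (finite_setOf_bichromaticLine hRB)
  rw [hPc, hR]
  refine add_sub_one_le_of_joining_bounds (hRc.trans hR) hBc hB (by omega) (by omega)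
    (fun h => card_le_card_joiningLines hL hRL hBL' (Finset.card_pos.1 h))
    (fun h => two_mul_card_le_or_le_card_joiningLines hL hRL hBL' (Finset.card_pos.1 h))
    (fun h => card_le_card_joiningLines hL hBL hRL' (Finset.card_pos.1 h))
    (fun h => two_mul_card_le_or_le_card_joiningLines hL hBL hRL' (Finset.card_pos.1 h))
    (hFG ▸ hcount _ fun M hM => (hsub M hM).1) fun ha hb => ?_
  obtain ⟨p, hp⟩ := Finset.card_pos.1 ha
  obtain ⟨q, hq⟩ := Finset.card_pos.1 hb
  rw [Finset.mem_filter] at hp hq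
  rw [← hF, ← hG, ← hFG, ← Finset.card_insert_of_notMem fun h => (hsub L h).2 rfl]
  refine hcount _ fun M hM => ?_
  rcases Finset.mem_insert.1 hM with rfl | hM
  · exact bichromaticLine_of_mem hRB hL hp.1 hq.1 hp.2 hq.2
  · exact (hsub M hM).1
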